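/- Let P_r(θ) := (1 − r²)/(1 − 2r·cos θ + r²) = Σ_{j ∈ ℤ} r^{|j|} exp(ijθ) denote the Poisson kernel, 0 ≤ r < 1. For every ξ ∈ H and every r ∈ [0,1), the H-valued Bochner integral (1/(2π)²)·∫₀^{2π}∫₀^{2π} P_r(θ₁)·P_r(θ₂)·ρ_{θ₁,θ₂}ξ dθ₁ dθ₂ equals the sum of the summable family (r^{|k|+|l|}·⟪ξ, e^{kl}⟫·e^{kl})_{(k,l) ∈ ℤ²}. -/

import Mathlib

open MeasureTheory AddCircle Complex

noncomputable section

instance : Fact ((0:ℝ) < 2 * Real.pi) := ⟨by positivity⟩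

/-- The normalized Haar probability measure on `𝕋 = ℝ/2πℤ`. -/
abbrev m2pi : Measure (AddCircle (2 * Real.pi)) := @haarAddCircle (2 * Real.pi) _

/-- The Hilbert space `H = ℓ²(ℤ; L²(𝕋, m))`. -/
abbrev H : Type := lp (fun _ : ℤ => Lp ℂ 2 m2pi) 2

/-- The vector `e^{kl} ∈ H` whose `n`-th component is `θ ↦ exp (i l θ)` if `n = k`
and `0` otherwise. -/
def e (k l : ℤ) : H := lp.single 2 k (fourierLp 2 l)

/-- `IsRho θ₁ θ₂ ρ` says that `ρ : H → H` is given componentwise by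
`(ρ ξ)_n(θ) = exp (i n θ₂) · ξ_n(θ + θ₁)`. -/
def IsRho (θ₁ θ₂ : ℝ) (ρ : H → H) : Prop :=
  ∀ (ξ : H) (n : ℤ),
    (ρ ξ n : AddCircle (2 * Real.pi) → ℂ) =ᵐ[m2pi]
      fun θ => Complex.exp (Complex.I * n * θ₂) * (ξ n (θ + (θ₁ : AddCircle (2 * Real.pi))))

/-- The Poisson kernel `P_r(θ) = (1 - r²)/(1 - 2 r cos θ + r²) = ∑_j r^{|j|} exp (i j θ)`. -/
def poisson (r θ : ℝ) : ℝ :=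
  (1 - r ^ 2) / (1 - 2 * r * Real.cos θ + r ^ 2)

lemma hasSum_congr_aux {f g : ℕ → ℂ} {a : ℂ} (hg : HasSum g a) (h : ∀ n, f n = g n) :
    HasSum f a := by
  rw [show f = g from funext h]
  exact hg

lemma real_smul_H (a : ℝ) (x : H) : a • x = (a : ℂ) • x :=
  (Complex.coe_smul a x).symm

lemma inner_e (k l : ℤ) (ξ : H) :
    inner ℂ (e k l) ξ = inner ℂ (fourierLp 2 l : Lp ℂ 2 m2pi) (ξ k) := by
  unfold e
  exact lp.inner_single_left k _ ξ

lemma orthonormal_e : Orthonormal ℂ (fun kl : ℤ × ℤ => e kl.1 kl.2) := by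
  rw [orthonormal_iff_ite]
  rintro ⟨k, l⟩ ⟨k', l'⟩
  simp only [inner_e]
  have ho := (orthonormal_iff_ite (𝕜 := ℂ)).1 (orthonormal_fourier (T := 2 * Real.pi)) l l'
  by_cases hk : k = k'
  · subst hk
    have : (e k l' : H) k = fourierLp 2 l' := by
      unfold e
      exact lp.single_apply_self 2 k _
    rw [this, ho]
    simp
  · have : (e k' l' : H) k = 0 := by
      unfold e
      exact lp.single_apply_ne 2 k' _ hk
    rw [this]
    simp [hk]

lemma total_e : (Submodule.span ℂ (Set.range (fun kl : ℤ × ℤ => e kl.1 kl.2)))ᗮ = ⊥ := by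
  rw [Submodule.eq_bot_iff]
  intro x hx
  have h : ∀ k l, inner ℂ (e k l) x = 0 := fun k l =>
    hx _ (Submodule.subset_span ⟨(k, l), rfl⟩)
  ext1
  funext k
  have hs := (fourierBasis (T := 2 * Real.pi)).hasSum_repr (x k)
  have h0 : ∀ l, (fourierBasis (T := 2 * Real.pi)).repr (x k) l = 0 := by
    intro l
    rw [HilbertBasis.repr_apply_apply, coe_fourierBasis, ← inner_e]
    exact h k l
  simp only [h0, zero_smul] at hs
  exact hs.unique hasSum_zero

def eBasis : HilbertBasis (ℤ × ℤ) ℂ H :=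
  HilbertBasis.mkOfOrthogonalEqBot orthonormal_e total_e

lemma eBasis_apply (kl : ℤ × ℤ) : eBasis kl = e kl.1 kl.2 := by
  unfold eBasis
  rw [HilbertBasis.coe_mkOfOrthogonalEqBot]

lemma eBasis_repr (x : H) (kl : ℤ × ℤ) : eBasis.repr x kl = inner ℂ (e kl.1 kl.2) x := by
  rw [HilbertBasis.repr_apply_apply, eBasis_apply]

lemma norm_eq_of_coeff (x y : H)
    (h : ∀ k l, ‖inner ℂ (e k l) x‖ = ‖inner ℂ (e k l) y‖) : ‖x‖ = ‖y‖ := by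
  rw [← eBasis.repr.norm_map x, ← eBasis.repr.norm_map y]
  rw [lp.norm_eq_tsum_rpow (by norm_num), lp.norm_eq_tsum_rpow (by norm_num)]
  simp only [eBasis_repr, h]

lemma inner_rho (θ₁ θ₂ : ℝ) (R : H → H) (hR : IsRho θ₁ θ₂ R) (ξ : H) (k l : ℤ) :
    inner ℂ (e k l) (R ξ) =
      Complex.exp (Complex.I * l * θ₁) * Complex.exp (Complex.I * k * θ₂) *
        inner ℂ (e k l) ξ := by
  rw [inner_e, inner_e, L2.inner_def, L2.inner_def]
  have h1 := coeFn_fourierLp (T := 2 * Real.pi) 2 l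
  have h2 := hR ξ k
  set g : AddCircle (2 * Real.pi) → ℂ := fun θ => inner ℂ (fourier l θ) (ξ k θ) with hg
  have e1 : ∫ a, inner ℂ ((fourierLp 2 l : Lp ℂ 2 m2pi) a) ((R ξ) k a) ∂m2pi
      = ∫ a, (Complex.exp (Complex.I * l * θ₁) * Complex.exp (Complex.I * k * θ₂)) *
          g (a + (θ₁ : AddCircle (2 * Real.pi))) ∂m2pi := by
    apply integral_congr_ae
    filter_upwards [h1, h2] with a ha1 ha2
    rw [ha1, ha2, hg]
    have hf : fourier l (a + (θ₁ : AddCircle (2 * Real.pi)))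
        = fourier l a * Complex.exp (Complex.I * l * θ₁) := by
      have : Complex.exp (Complex.I * l * θ₁)
          = fourier l (θ₁ : AddCircle (2 * Real.pi)) := by
        rw [fourier_coe_apply]
        congr 1
        have : (Real.pi : ℂ) ≠ 0 := by exact_mod_cast Real.pi_ne_zero
        push_cast
        field_simp
      rw [this, fourier_apply, fourier_apply, fourier_apply, zsmul_add, toCircle_add,
        Circle.coe_mul]
    have hc : Complex.exp (Complex.I * l * θ₁) *
        (starRingEnd ℂ) (Complex.exp (Complex.I * l * θ₁)) = 1 := by
      rw [← Complex.exp_conj, ← Complex.exp_add]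
      simp
    simp only [RCLike.inner_apply, hf, map_mul]
    linear_combination (-(Complex.exp (Complex.I * k * θ₂) *
      (ξ k (a + (θ₁ : AddCircle (2 * Real.pi)))) * (starRingEnd ℂ) (fourier l a))) * hc
  have e2 : ∫ a, inner ℂ ((fourierLp 2 l : Lp ℂ 2 m2pi) a) (ξ k a) ∂m2pi = ∫ a, g a ∂m2pi := by
    apply integral_congr_ae
    filter_upwards [h1] with a ha1
    rw [ha1, hg]
  rw [e1, e2, integral_const_mul, integral_add_right_eq_self]

lemma norm_expI (l : ℤ) (t : ℝ) : ‖Complex.exp (Complex.I * l * t)‖ = 1 := by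
  rw [show Complex.I * l * t = ((l * t : ℝ) : ℂ) * Complex.I by push_cast; ring]
  exact Complex.norm_exp_ofReal_mul_I _

lemma continuous_rho (ρ : ℝ → ℝ → H → H)
    (hρ : ∀ θ₁ θ₂ : ℝ, IsRho θ₁ θ₂ (ρ θ₁ θ₂)) (ξ : H) :
    Continuous (fun p : ℝ × ℝ => ρ p.1 p.2 ξ) := by
  have hs : HasSum (fun i => eBasis.repr ξ i • eBasis i) ξ := eBasis.hasSum_repr ξ
  let w : ℝ × ℝ → ℤ × ℤ → ℂ := fun p i =>
    Complex.exp (Complex.I * i.2 * p.1) * Complex.exp (Complex.I * i.1 * p.2)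
  have hw : ∀ p i, ‖w p i‖ = 1 := by
    intro p i
    simp only [w, norm_mul, norm_expI, one_mul]
  let F : Finset (ℤ × ℤ) → ℝ × ℝ → H := fun s p =>
    ∑ i ∈ s, (w p i * eBasis.repr ξ i) • eBasis i
  have hF : TendstoUniformly F (fun p : ℝ × ℝ => ρ p.1 p.2 ξ) Filter.atTop := by
    rw [Metric.tendstoUniformly_iff]
    intro ε hε
    have := (Metric.tendsto_nhds.1 hs) ε hε
    filter_upwards [this] with s hsε p
    rw [dist_comm] at hsε
    have hn : ‖ρ p.1 p.2 ξ - F s p‖ = ‖ξ - ∑ i ∈ s, eBasis.repr ξ i • eBasis i‖ := by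
      apply norm_eq_of_coeff
      intro k l
      have hin : ∀ c : ℤ × ℤ → ℂ, inner ℂ (e k l) (∑ i ∈ s, c i • eBasis i)
          = if (k, l) ∈ s then c (k, l) else 0 := by
        intro c
        rw [inner_sum]
        have : ∀ i, inner ℂ (e k l) (c i • eBasis i) = if (k, l) = i then c i else 0 := by
          intro i
          rw [inner_smul_right, eBasis_apply,
            (orthonormal_iff_ite (𝕜 := ℂ)).1 orthonormal_e (k, l) i]
          simp
        simp only [this, Finset.sum_ite_eq]
      rw [inner_sub_right, inner_sub_right, hin, hin, inner_rho _ _ _ (hρ p.1 p.2)]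
      have hwk := hw p (k, l)
      have : ∀ z z' : ℂ, z' = w p (k, l) * z → ‖z'‖ = ‖z‖ := by
        intro z z' h
        rw [h, norm_mul, hwk, one_mul]
      apply this
      rw [eBasis_repr]
      simp only [w]
      split_ifs <;> ring
    rw [dist_eq_norm, hn, ← dist_eq_norm]
    exact hsε
  refine hF.continuous (Filter.Frequently.of_forall fun s => ?_)
  simp only [F, w]
  fun_prop

lemma hasSum_poisson (r : ℝ) (hr0 : 0 ≤ r) (hr1 : r < 1) (θ : ℝ) :
    HasSum (fun j : ℤ => (r : ℂ) ^ j.natAbs * Complex.exp (Complex.I * j * θ))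
      (poisson r θ : ℂ) := by
  set u := Complex.exp (Complex.I * θ) with hu
  set v := Complex.exp (-(Complex.I * θ)) with hv
  have huv : u * v = 1 := by rw [hu, hv, ← Complex.exp_add]; simp
  have hun : ‖u‖ = 1 := by have := norm_expI 1 θ; simpa [hu] using this
  have hvn : ‖v‖ = 1 := by have := norm_expI (-1) θ; simpa [hv] using this
  have hcos : (2 * Real.cos θ : ℂ) = u + v := by
    rw [Complex.ofReal_cos, Complex.two_cos, hu, hv]
    ring_nf
  have n1 : ‖(r : ℂ) * u‖ < 1 := by
    rw [norm_mul, hun, Complex.norm_of_nonneg hr0]; linarith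
  have n2 : ‖(r : ℂ) * v‖ < 1 := by
    rw [norm_mul, hvn, Complex.norm_of_nonneg hr0]; linarith
  have g1 := hasSum_geometric_of_norm_lt_one n1
  have g2 := (hasSum_geometric_of_norm_lt_one n2).mul_left ((r : ℂ) * v)
  have d1 : 1 - (r : ℂ) * u ≠ 0 := by
    intro h
    rw [← sub_eq_zero.1 h] at n1
    simp at n1
  have d2 : 1 - (r : ℂ) * v ≠ 0 := by
    intro h
    rw [← sub_eq_zero.1 h] at n2
    simp at n2
  have := HasSum.of_nat_of_neg_add_one
    (f := fun j : ℤ => (r : ℂ) ^ j.natAbs * Complex.exp (Complex.I * j * θ))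
    (m := (1 - (r : ℂ) * u)⁻¹) (m' := (r : ℂ) * v * (1 - (r : ℂ) * v)⁻¹) ?_ ?_
  · convert this using 1
    unfold poisson
    have hden : (1 - 2 * (r : ℂ) * Real.cos θ + r ^ 2) = (1 - (r : ℂ) * u) * (1 - (r : ℂ) * v) := by
      linear_combination (-(r : ℂ)) * hcos - (r : ℂ) ^ 2 * huv
    push_cast [-Complex.ofReal_cos]
    rw [hden]
    field_simp
    linear_combination (r : ℂ) ^ 2 * huv
  · refine hasSum_congr_aux g1 fun n => ?_
    rw [mul_pow, hu, ← Complex.exp_nat_mul]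
    simp only [Int.natAbs_natCast, Int.cast_natCast]
    ring_nf
  · refine hasSum_congr_aux g2 fun n => ?_
    rw [← pow_succ', mul_pow, hv, ← Complex.exp_nat_mul]
    have : (-((n : ℤ) + 1)).natAbs = n + 1 := by omega
    rw [this]
    push_cast
    ring_nf

lemma integral_expI (j : ℤ) :
    ∫ θ in (0:ℝ)..(2 * Real.pi), Complex.exp (Complex.I * j * θ)
      = if j = 0 then (2 * Real.pi : ℂ) else 0 := by
  split_ifs with h
  · subst h
    simp
  · rw [integral_exp_mul_complex (mul_ne_zero Complex.I_ne_zero (by exact_mod_cast h))]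
    have : Complex.exp (Complex.I * j * ((2 * Real.pi : ℝ) : ℂ)) = 1 := by
      rw [Complex.exp_eq_one_iff]
      exact ⟨j, by push_cast; ring⟩
    rw [this]
    simp

lemma integral_poisson (r : ℝ) (hr0 : 0 ≤ r) (hr1 : r < 1) (k : ℤ) :
    ∫ θ in (0:ℝ)..(2 * Real.pi), (poisson r θ : ℂ) * Complex.exp (Complex.I * k * θ)
      = (2 * Real.pi : ℂ) * (r : ℂ) ^ k.natAbs := by
  have hS : Summable (fun j : ℤ => r ^ j.natAbs) := by
    apply Summable.of_nat_of_neg_add_one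
    · simpa using summable_geometric_of_lt_one hr0 hr1
    · have := (summable_geometric_of_lt_one hr0 hr1).mul_left r
      refine this.congr fun n => ?_
      have h : (-((n : ℤ) + 1)).natAbs = n + 1 := by omega
      rw [h, pow_succ']
  have h := intervalIntegral.hasSum_integral_of_dominated_convergence
    (μ := volume) (a := 0) (b := 2 * Real.pi)
    (F := fun (j : ℤ) (θ : ℝ) => (r : ℂ) ^ j.natAbs * Complex.exp (Complex.I * j * θ) *
      Complex.exp (Complex.I * k * θ))
    (f := fun θ => (poisson r θ : ℂ) * Complex.exp (Complex.I * k * θ))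
    (fun j _ => r ^ j.natAbs)
    (fun j => by
      apply Continuous.aestronglyMeasurable
      fun_prop)
    (fun j => by
      filter_upwards with t _
      rw [norm_mul, norm_mul, norm_expI, norm_expI, norm_pow, Complex.norm_of_nonneg hr0]
      simp)
    (by
      filter_upwards with t _
      exact hS)
    (by simp)
    (by
      filter_upwards with t _
      exact (hasSum_poisson r hr0 hr1 t).mul_right _)
  have h2 : ∀ j : ℤ, ∫ θ in (0:ℝ)..(2 * Real.pi),
      (r : ℂ) ^ j.natAbs * Complex.exp (Complex.I * j * θ) * Complex.exp (Complex.I * k * θ)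
      = if j = -k then (2 * Real.pi : ℂ) * (r : ℂ) ^ k.natAbs else 0 := by
    intro j
    have : ∀ θ : ℝ, (r : ℂ) ^ j.natAbs * Complex.exp (Complex.I * j * θ) *
        Complex.exp (Complex.I * k * θ)
        = (r : ℂ) ^ j.natAbs * Complex.exp (Complex.I * (j + k : ℤ) * θ) := by
      intro θ
      rw [mul_assoc, ← Complex.exp_add]
      push_cast
      ring_nf
    simp only [this]
    rw [intervalIntegral.integral_const_mul, integral_expI]
    by_cases hj : j = -k
    · subst hj
      simp [mul_comm]
    · have : j + k ≠ 0 := by omega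
      simp [this, hj]
  simp only [h2] at h
  exact h.unique (hasSum_ite_eq (-k) _)

lemma continuous_poisson (r : ℝ) (hr0 : 0 ≤ r) (hr1 : r < 1) : Continuous (poisson r) := by
  unfold poisson
  refine Continuous.div (by fun_prop) (by fun_prop) fun θ => ?_
  have := Real.cos_le_one θ
  nlinarith [mul_nonneg hr0 (sub_nonneg.2 this), sq_nonneg (1 - r), mul_pos (sub_pos.2 hr1) (sub_pos.2 hr1)]

lemma inner_integral (ρ : ℝ → ℝ → H → H)
    (hρ : ∀ θ₁ θ₂ : ℝ, IsRho θ₁ θ₂ (ρ θ₁ θ₂)) (ξ : H) (r : ℝ) (hr0 : 0 ≤ r) (hr1 : r < 1)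
    (k l : ℤ) :
    inner ℂ (e k l) (∫ θ₁ in (0:ℝ)..(2 * Real.pi), ∫ θ₂ in (0:ℝ)..(2 * Real.pi),
          (poisson r θ₁ * poisson r θ₂) • ρ θ₁ θ₂ ξ)
      = ((2 * Real.pi : ℂ) * (r : ℂ) ^ l.natAbs) * ((2 * Real.pi : ℂ) * (r : ℂ) ^ k.natAbs)
        * inner ℂ (e k l) ξ := by
  have hP := continuous_poisson r hr0 hr1
  have hc := continuous_rho ρ hρ ξ
  have hF : Continuous (fun p : ℝ × ℝ => (poisson r p.1 * poisson r p.2) • ρ p.1 p.2 ξ) := by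
    fun_prop
  have hI : Continuous (fun θ₁ : ℝ => ∫ θ₂ in (0:ℝ)..(2 * Real.pi),
      (poisson r θ₁ * poisson r θ₂) • ρ θ₁ θ₂ ξ) :=
    intervalIntegral.continuous_parametric_intervalIntegral_of_continuous' hF _ _
  have hF1 : ∀ θ₁, Continuous (fun θ₂ : ℝ => (poisson r θ₁ * poisson r θ₂) • ρ θ₁ θ₂ ξ) :=
    fun θ₁ => Continuous.comp
      (g := fun p : ℝ × ℝ => (poisson r p.1 * poisson r p.2) • ρ p.1 p.2 ξ)
      (f := fun θ₂ : ℝ => (θ₁, θ₂)) hF (by fun_prop)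
  have s1 := (innerSL ℂ (e k l)).intervalIntegral_comp_comm
    (hI.intervalIntegrable (μ := volume) 0 (2 * Real.pi))
  rw [innerSL_apply_apply] at s1
  rw [← s1]
  have s2 : ∀ θ₁ : ℝ, innerSL ℂ (e k l) (∫ θ₂ in (0:ℝ)..(2 * Real.pi),
      (poisson r θ₁ * poisson r θ₂) • ρ θ₁ θ₂ ξ) =
      (poisson r θ₁ : ℂ) * Complex.exp (Complex.I * l * θ₁) *
        (((2 * Real.pi : ℂ) * (r : ℂ) ^ k.natAbs) * inner ℂ (e k l) ξ) := by
    intro θ₁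
    rw [← (innerSL ℂ (e k l)).intervalIntegral_comp_comm
      ((hF1 θ₁).intervalIntegrable (μ := volume) 0 (2 * Real.pi))]
    have : ∀ θ₂ : ℝ, innerSL ℂ (e k l) ((poisson r θ₁ * poisson r θ₂) • ρ θ₁ θ₂ ξ)
        = ((poisson r θ₁ : ℂ) * Complex.exp (Complex.I * l * θ₁) * inner ℂ (e k l) ξ) *
          ((poisson r θ₂ : ℂ) * Complex.exp (Complex.I * k * θ₂)) := by
      intro θ₂
      rw [innerSL_apply_apply, real_smul_H, inner_smul_right, inner_rho _ _ _ (hρ θ₁ θ₂)]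
      push_cast
      ring
    simp only [this]
    rw [intervalIntegral.integral_const_mul, integral_poisson r hr0 hr1]
    ring
  simp only [s2]
  rw [intervalIntegral.integral_mul_const, integral_poisson r hr0 hr1]
  ring

/-- The transference identity for Abel means: the Bochner integral
`(1/(2π)²) ∫₀^{2π}∫₀^{2π} P_r(θ₁) P_r(θ₂) ρ_{θ₁,θ₂} ξ dθ₁ dθ₂` is the sum of the summable
family `(r^{|k|+|l|} ⟪ξ, e^{kl}⟫ e^{kl})_{(k,l) ∈ ℤ²}`.
(The pairing `⟪ξ, e^{kl}⟫`, linear in `ξ`, is `inner (e k l) ξ` in Mathlib's convention.) -/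
theorem poisson_transference (ρ : ℝ → ℝ → H → H)
    (hρ : ∀ θ₁ θ₂ : ℝ, IsRho θ₁ θ₂ (ρ θ₁ θ₂)) (ξ : H) (r : ℝ) (hr0 : 0 ≤ r) (hr1 : r < 1) :
    HasSum
      (fun kl : ℤ × ℤ =>
        (((r : ℂ) ^ (|kl.1| + |kl.2|).toNat) * inner (𝕜 := ℂ) (e kl.1 kl.2) ξ) • e kl.1 kl.2)
      ((1 / (2 * Real.pi) ^ 2) •
        (∫ θ₁ in (0:ℝ)..(2 * Real.pi), ∫ θ₂ in (0:ℝ)..(2 * Real.pi),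
          (poisson r θ₁ * poisson r θ₂) • ρ θ₁ θ₂ ξ)) := by
  set J := ∫ θ₁ in (0:ℝ)..(2 * Real.pi), ∫ θ₂ in (0:ℝ)..(2 * Real.pi),
          (poisson r θ₁ * poisson r θ₂) • ρ θ₁ θ₂ ξ with hJ
  have h := eBasis.hasSum_repr ((1 / (2 * Real.pi) ^ 2) • J)
  convert h using 2 with kl
  rw [eBasis_repr, eBasis_apply, real_smul_H, inner_smul_right, hJ,
    inner_integral ρ hρ ξ r hr0 hr1]
  congr 1
  have hn : (|kl.1| + |kl.2|).toNat = kl.2.natAbs + kl.1.natAbs := by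
    rw [Int.abs_eq_natAbs, Int.abs_eq_natAbs]
    omega
  have : (Real.pi : ℂ) ≠ 0 := by exact_mod_cast Real.pi_ne_zero
  rw [hn, pow_add]
  push_cast
  field_simp

end
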